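/- For every t > 0, every k ∈ {1, …, n}, and every x ∈ ℝ with |x − y_k| ≤ Δ/2, one has |(d/dx) log p_t(x) − (y_k − x)/t| ≤ (2(n − 1) D / t) · exp(−Δ²/t). -/

import Mathlib

open MeasureTheory Real Set Filter
open scoped ENNReal

/-- Centered Gaussian density with standard deviation `σ`. -/
noncomputable def gaussD (x σ : ℝ) : ℝ :=
  (Real.sqrt (2 * Real.pi) * σ)⁻¹ * Real.exp (-x ^ 2 / (2 * σ ^ 2))

/-- Training points `y_k = 2(k-1)Δ - D`, `Δ = D/(n-1)`. -/
noncomputable def trainPt (n : ℕ) (D : ℝ) (k : ℕ) : ℝ :=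
  2 * ((k : ℝ) - 1) * (D / ((n : ℝ) - 1)) - D

/-- Noised empirical density `p_t`. -/
noncomputable def pEmp (n : ℕ) (D t x : ℝ) : ℝ :=
  (1 / (n : ℝ)) * ∑ k ∈ Finset.Icc 1 n, gaussD (x - trainPt n D k) (Real.sqrt t)

/-- Empirical score function `(d/dx) log p_t`. -/
noncomputable def scoreEmp (n : ℕ) (D t x : ℝ) : ℝ :=
  deriv (fun y => Real.log (pEmp n D t y)) x

/-- Score matching loss `L_t[f]`. -/
noncomputable def scoreLoss (n : ℕ) (D t : ℝ) (f : ℝ → ℝ) : ℝ :=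
  t * ∫ x, |f x - scoreEmp n D t x| ^ 2 * pEmp n D t x

/-- `F(κ) = 2 ∫_κ^∞ (u-κ)² p_N(u;1) du`. -/
noncomputable def Fgauss (κ : ℝ) : ℝ :=
  2 * ∫ u in Set.Ioi κ, (u - κ) ^ 2 * gaussD u 1

/-- The smoothed piecewise-linear empirical score function `ŝ_{t,δ}` (as a predicate
characterizing it by its defining piecewise formulas). -/
def IsShat (n : ℕ) (D t δ : ℝ) (s : ℝ → ℝ) : Prop :=
  (∀ x ≤ trainPt n D 1 + δ, s x = (trainPt n D 1 - x) / t) ∧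
  (∀ x, trainPt n D n - δ ≤ x → s x = (trainPt n D n - x) / t) ∧
  (∀ k, 2 ≤ k → k ≤ n - 1 →
    ∀ x ∈ Set.Icc (trainPt n D k - δ) (trainPt n D k + δ),
      s x = (trainPt n D k - x) / t) ∧
  (∀ k, 1 ≤ k → k ≤ n - 1 →
    ∀ x ∈ Set.Icc (trainPt n D k + δ) (trainPt n D (k + 1) - δ),
      s x = (δ / (D / ((n : ℝ) - 1) - δ)) * (x - (trainPt n D k + D / ((n : ℝ) - 1))) / t)

/-- Non-smoothness measure `R[f]`: the total variation over ℝ of the derivative `f'`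
(taken over the set where `f` is differentiable). -/
noncomputable def Rns (f : ℝ → ℝ) : ℝ≥0∞ :=
  eVariationOn (deriv f) {x | DifferentiableAt ℝ f x}

theorem gaussD_pos (x : ℝ) {σ : ℝ} (hσ : 0 < σ) : 0 < gaussD x σ := by
  unfold gaussD
  positivity

theorem hasDerivAt_gaussD_sub {t : ℝ} (ht : 0 < t) (a x : ℝ) :
    HasDerivAt (fun y => gaussD (y - a) (√t)) (gaussD (x - a) (√t) * ((a - x) / t)) x := by
  unfold gaussD
  rw [Real.sq_sqrt ht.le]
  have h : HasDerivAt (fun y : ℝ => -(y - a) ^ 2 / (2 * t)) ((a - x) / t) x := by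
    have h1 := ((((hasDerivAt_id x).sub_const a).pow 2).neg).div_const (2 * t)
    refine h1.congr_deriv ?_
    simp
    field_simp
    ring
  refine (h.exp.const_mul (√(2 * Real.pi) * √t)⁻¹).congr_deriv ?_
  ring

theorem trainPt_sub (n : ℕ) (D : ℝ) (j k : ℕ) :
    trainPt n D j - trainPt n D k = 2 * ((j : ℝ) - k) * (D / ((n : ℝ) - 1)) := by
  unfold trainPt
  ring

theorem abs_trainPt_sub_le {n : ℕ} (hn : 2 ≤ n) {D : ℝ} (hD : 0 < D) {j k : ℕ}
    (hj1 : 1 ≤ j) (hjn : j ≤ n) (hk1 : 1 ≤ k) (hkn : k ≤ n) :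
    |trainPt n D j - trainPt n D k| ≤ 2 * D := by
  have hn' : (2 : ℝ) ≤ n := by exact_mod_cast hn
  have hΔ : 0 < D / ((n : ℝ) - 1) := div_pos hD (by linarith)
  have hjk : |(j : ℝ) - k| ≤ (n : ℝ) - 1 := by
    have h1 : (1 : ℝ) ≤ j := by exact_mod_cast hj1
    have h2 : (j : ℝ) ≤ n := by exact_mod_cast hjn
    have h3 : (1 : ℝ) ≤ k := by exact_mod_cast hk1
    have h4 : (k : ℝ) ≤ n := by exact_mod_cast hkn
    exact abs_le.2 ⟨by linarith, by linarith⟩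
  rw [trainPt_sub, abs_mul, abs_mul, abs_two, abs_of_pos hΔ]
  calc 2 * |(j : ℝ) - k| * (D / ((n : ℝ) - 1))
      ≤ 2 * ((n : ℝ) - 1) * (D / ((n : ℝ) - 1)) := by gcongr
    _ = 2 * D := by
      have : (n : ℝ) - 1 ≠ 0 := by linarith
      field_simp

theorem two_mul_spacing_le_abs_trainPt_sub {n : ℕ} (hn : 2 ≤ n) {D : ℝ} (hD : 0 < D) {j k : ℕ}
    (hjk : j ≠ k) : 2 * (D / ((n : ℝ) - 1)) ≤ |trainPt n D j - trainPt n D k| := by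
  have hn' : (2 : ℝ) ≤ n := by exact_mod_cast hn
  have hΔ : 0 < D / ((n : ℝ) - 1) := div_pos hD (by linarith)
  have h : (1 : ℝ) ≤ |(j : ℝ) - k| := by
    have h0 : (1 : ℤ) ≤ |(j : ℤ) - k| := Int.one_le_abs (by omega)
    exact_mod_cast h0
  rw [trainPt_sub, abs_mul, abs_mul, abs_two, abs_of_pos hΔ]
  nlinarith

theorem gaussD_sub_le {t r : ℝ} (ht : 0 < t) (hr : 0 ≤ r) {a b x : ℝ}
    (hx : |x - a| ≤ r / 2) (hab : 2 * r ≤ |b - a|) :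
    gaussD (x - b) (√t) ≤ gaussD (x - a) (√t) * Real.exp (-r ^ 2 / t) := by
  unfold gaussD
  rw [Real.sq_sqrt ht.le, mul_assoc, ← Real.exp_add]
  have hcross : (x - a) * (b - a) ≤ r / 2 * |b - a| :=
    (le_abs_self _).trans (by rw [abs_mul]; gcongr)
  have hsq : (x - a) ^ 2 + 2 * r ^ 2 ≤ (x - b) ^ 2 := by
    nlinarith [sq_abs (b - a)]
  gcongr
  rw [show -(x - a) ^ 2 / (2 * t) + -r ^ 2 / t = -((x - a) ^ 2 + 2 * r ^ 2) / (2 * t) by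
    field_simp; ring]
  gcongr

theorem scoreEmp_eq {n : ℕ} (hn : 1 ≤ n) (D : ℝ) {t : ℝ} (ht : 0 < t) (x : ℝ) :
    scoreEmp n D t x =
      (∑ j ∈ Finset.Icc 1 n, gaussD (x - trainPt n D j) (√t) * ((trainPt n D j - x) / t)) /
        ∑ j ∈ Finset.Icc 1 n, gaussD (x - trainPt n D j) (√t) := by
  have hS : 0 < ∑ j ∈ Finset.Icc 1 n, gaussD (x - trainPt n D j) (√t) :=
    Finset.sum_pos (fun j _ => gaussD_pos _ (Real.sqrt_pos.2 ht)) ⟨1, by simpa using hn⟩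
  have hn0 : (n : ℝ) ≠ 0 := by positivity
  have hd : HasDerivAt (fun y => pEmp n D t y) _ x :=
    (HasDerivAt.fun_sum fun j (_ : j ∈ Finset.Icc 1 n) =>
      hasDerivAt_gaussD_sub ht (trainPt n D j) x).const_mul (1 / (n : ℝ))
  have hp : pEmp n D t x ≠ 0 := mul_ne_zero (one_div_ne_zero hn0) hS.ne'
  unfold scoreEmp
  rw [(hd.log hp).deriv, pEmp, mul_div_mul_left _ _ (one_div_ne_zero hn0)]

/-- near each training point `y_k` (within `Δ/2`), the empirical score
function is exponentially close to the linear function `(y_k - x)/t`: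
`|(d/dx) log p_t(x) - (y_k - x)/t| ≤ (2(n-1)D/t)·exp(-Δ²/t)`. -/
theorem stmt_18 (n : ℕ) (hn : 2 ≤ n) (D : ℝ) (hD : 0 < D) (t : ℝ) (ht : 0 < t)
    (k : ℕ) (hk1 : 1 ≤ k) (hkn : k ≤ n) (x : ℝ)
    (hx : |x - trainPt n D k| ≤ (D / ((n : ℝ) - 1)) / 2) :
    |scoreEmp n D t x - (trainPt n D k - x) / t| ≤
      (2 * ((n : ℝ) - 1) * D / t) * Real.exp (-(D / ((n : ℝ) - 1)) ^ 2 / t) := by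
  set y := trainPt n D
  set w : ℕ → ℝ := fun j => gaussD (x - y j) (√t) with hw
  set E := Real.exp (-(D / ((n : ℝ) - 1)) ^ 2 / t)
  have hn' : (2 : ℝ) ≤ n := by exact_mod_cast hn
  have hΔ : 0 < D / ((n : ℝ) - 1) := div_pos hD (by linarith)
  have hwpos : ∀ j, 0 < w j := fun j => gaussD_pos _ (Real.sqrt_pos.2 ht)
  have hkmem : k ∈ Finset.Icc 1 n := Finset.mem_Icc.2 ⟨hk1, hkn⟩
  have hwk : w k ≤ ∑ j ∈ Finset.Icc 1 n, w j :=
    Finset.single_le_sum (fun j _ => (hwpos j).le) hkmem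
  have hS : 0 < ∑ j ∈ Finset.Icc 1 n, w j := (hwpos k).trans_le hwk
  have hdiff : scoreEmp n D t x - (y k - x) / t =
      (∑ j ∈ (Finset.Icc 1 n).erase k, w j * ((y j - y k) / t)) / ∑ j ∈ Finset.Icc 1 n, w j := by
    rw [scoreEmp_eq (by omega) D ht, Finset.sum_erase _ (by simp), eq_div_iff hS.ne', sub_mul,
      div_mul_cancel₀ _ hS.ne', Finset.mul_sum, ← Finset.sum_sub_distrib]
    refine Finset.sum_congr rfl fun j _ => ?_
    simp only [hw]
    ring
  have hterm : ∀ j ∈ (Finset.Icc 1 n).erase k,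
      |w j * ((y j - y k) / t)| ≤ w k * E * (2 * D / t) := by
    intro j hj
    obtain ⟨hjk, hj⟩ := Finset.mem_erase.1 hj
    obtain ⟨hj1, hjn⟩ := Finset.mem_Icc.1 hj
    rw [abs_mul, abs_div, abs_of_pos (hwpos j), abs_of_pos ht]
    have h1 : w j ≤ w k * E :=
      gaussD_sub_le ht hΔ.le hx (two_mul_spacing_le_abs_trainPt_sub hn hD hjk)
    have h2 : |y j - y k| ≤ 2 * D := abs_trainPt_sub_le hn hD hj1 hjn hk1 hkn
    have h3 := hwpos k
    gcongr
  rw [hdiff, abs_div, abs_of_pos hS, div_le_iff₀ hS]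
  calc |∑ j ∈ (Finset.Icc 1 n).erase k, w j * ((y j - y k) / t)|
      ≤ ∑ j ∈ (Finset.Icc 1 n).erase k, |w j * ((y j - y k) / t)| :=
        Finset.abs_sum_le_sum_abs _ _
    _ ≤ ((Finset.Icc 1 n).erase k).card • (w k * E * (2 * D / t)) :=
        Finset.sum_le_card_nsmul _ _ _ hterm
    _ = 2 * ((n : ℝ) - 1) * D / t * E * w k := by
        rw [Finset.card_erase_of_mem hkmem, Nat.card_Icc, nsmul_eq_mul, Nat.add_sub_cancel,
          Nat.cast_sub (by omega), Nat.cast_one]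
        ring
    _ ≤ 2 * ((n : ℝ) - 1) * D / t * E * ∑ j ∈ Finset.Icc 1 n, w j := by
        have : 0 ≤ (n : ℝ) - 1 := by linarith
        gcongr
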